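/- arXiv:1907.12329 — 3 statements merged into one kernel-verified Lean document; each statement's English description precedes it below -/
import Mathlib

section
/- If m and n are positive integers with m ≡ 0 (mod 16), then the graph K_m □ K_n has an L_8-decomposition. -/
open SimpleGraph

/-- The sunlet graph `L₈` on 8 vertices: a 4-cycle on vertices `0,1,2,3`
together with pendant vertices `4,5,6,7`, where pendant `i+4` is attached
to cycle vertex `i`. -/
def sunlet8 : SimpleGraph (Fin 8) :=
  SimpleGraph.fromRel (fun a b =>
    (a.val < 4 ∧ b.val < 4 ∧ b.val = (a.val + 1) % 4) ∨ (a.val < 4 ∧ b.val = a.val + 4))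

/-- A set of edges is a copy of the sunlet graph `L₈` if it is the image of the
edge set of `sunlet8` under an injective map of vertices. -/
def IsSunletCopy {V : Type*} (s : Set (Sym2 V)) : Prop :=
  ∃ f : Fin 8 → V, Function.Injective f ∧ s = Sym2.map f '' sunlet8.edgeSet

/-- A graph `G` has an `L₈`-decomposition if its edge set can be partitioned into
parts, each of which induces a subgraph isomorphic to the sunlet graph `L₈`. -/
def HasSunletDecomposition {V : Type*} (G : SimpleGraph V) : Prop :=
  ∃ P : Set (Set (Sym2 V)),
    ⋃₀ P = G.edgeSet ∧ P.PairwiseDisjoint id ∧ ∀ s ∈ P, IsSunletCopy s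

/-- The eight edges of the sunlet. -/
def sunEdges : List (Fin 8 × Fin 8) :=
  [(0,1),(1,2),(2,3),(3,0),(0,4),(1,5),(2,6),(3,7)]

theorem sunlet8_adj : ∀ a b : Fin 8, sunlet8.Adj a b ↔ ((a,b) ∈ sunEdges ∨ (b,a) ∈ sunEdges) := by
  unfold sunlet8
  simp only [SimpleGraph.fromRel_adj]
  decide +kernel

theorem sunlet8_dec : HasSunletDecomposition sunlet8 := by
  refine ⟨{sunlet8.edgeSet}, by simp, by simp, ?_⟩
  intro s hs
  refine ⟨id, Function.injective_id, ?_⟩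
  rw [Set.mem_singleton_iff.1 hs]
  simp

/-- Gluing decompositions of edge-disjoint pieces. -/
theorem glue {V : Type} (G : SimpleGraph V) {ι : Type} {U : ι → Type}
    (K : ∀ i, SimpleGraph (U i)) (f : ∀ i, U i → V)
    (hf : ∀ i, Function.Injective (f i))
    (hD : ∀ i, HasSunletDecomposition (K i))
    (hsub : ∀ i u v, (K i).Adj u v → G.Adj (f i u) (f i v))
    (hcov : ∀ u v, G.Adj u v → ∃ i u' v', (K i).Adj u' v' ∧ f i u' = u ∧ f i v' = v)
    (hdisj : ∀ i j u v u' v', (K i).Adj u v → (K j).Adj u' v' →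
      f i u = f j u' → f i v = f j v' → i = j) :
    HasSunletDecomposition G := by
  choose P hP1 hP2 hP3 using hD
  have mem : ∀ i s e, s ∈ P i → e ∈ s → e ∈ (K i).edgeSet := by
    intro i s e hs he
    rw [← hP1 i]
    exact ⟨s, hs, he⟩
  refine ⟨{t | ∃ i, ∃ s ∈ P i, t = Sym2.map (f i) '' s}, ?_, ?_, ?_⟩
  · ext e
    constructor
    · rintro ⟨t, ⟨i, s, hs, rfl⟩, e', he', rfl⟩
      have := mem i s e' hs he'
      induction e' with
      | _ u v => exact hsub i u v this
    · induction e with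
      | _ u v =>
        intro he
        obtain ⟨i, u', v', h, rfl, rfl⟩ := hcov u v he
        have h' : s(u', v') ∈ (K i).edgeSet := h
        rw [← hP1 i] at h'
        obtain ⟨s, hs, hes⟩ := h'
        exact ⟨_, ⟨i, s, hs, rfl⟩, s(u', v'), hes, rfl⟩
  · rintro t ⟨i, s, hs, rfl⟩ t' ⟨j, s', hs', rfl⟩ hne
    simp only [Function.onFun, id]
    rw [Set.disjoint_left]
    rintro e ⟨e1, he1, rfl⟩ ⟨e2, he2, h12⟩
    have m1 := mem i s e1 hs he1
    have m2 := mem j s' e2 hs' he2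
    have hij : i = j := by
      induction e1 with
      | _ u v =>
        induction e2 with
        | _ u' v' =>
          rw [SimpleGraph.mem_edgeSet] at m1 m2
          simp only [Sym2.map_mk, Sym2.eq_iff] at h12
          rcases h12 with ⟨h, h'⟩ | ⟨h, h'⟩
          · exact (hdisj j i u' v' u v m2 m1 h h').symm
          · exact (hdisj j i u' v' v u m2 m1.symm h h').symm
    subst hij
    have : e2 = e1 := Sym2.map.injective (hf i) h12
    subst this
    have hss : s ≠ s' := by
      rintro rfl
      exact hne rfl
    exact Set.disjoint_left.1 (hP2 i hs hs' hss) he1 he2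
  · rintro t ⟨i, s, hs, rfl⟩
    obtain ⟨g, hg, rfl⟩ := hP3 i s hs
    refine ⟨f i ∘ g, (hf i).comp hg, ?_⟩
    rw [Sym2.map_comp, Set.image_comp]

theorem dec_iso {V W : Type} {G : SimpleGraph V} {H : SimpleGraph W} (e : G ≃g H)
    (h : HasSunletDecomposition G) : HasSunletDecomposition H := by
  refine glue H (ι := Unit) (fun _ => G) (fun _ => e) (fun _ => e.injective) (fun _ => h) ?_ ?_ ?_
  · intro _ u v huv
    exact e.map_adj_iff.2 huv
  · intro u v huv
    exact ⟨(), e.symm u, e.symm v, e.symm.map_adj_iff.2 huv, by simp, by simp⟩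
  · intros
    rfl

/-- Whether the sunlet (given by vertex codes) contains the edge `u v`. -/
def sunHas (u v : ℕ) (l : List ℕ) : Bool :=
  sunEdges.any fun p =>
    (Nat.beq (l.getD p.1 0) u && Nat.beq (l.getD p.2 0) v) ||
    (Nat.beq (l.getD p.1 0) v && Nat.beq (l.getD p.2 0) u)

/-- Index of the first sunlet in a list containing a given edge. -/
def sunIdx (L : List (List ℕ)) (u v : ℕ) : ℕ := L.findIdx (sunHas u v)

theorem check {V : Type} (G : SimpleGraph V)
    (dec : ℕ → V) (enc : V → ℕ) (L : List (List ℕ))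
    (hde : ∀ v, dec (enc v) = v)
    (hed : ∀ l ∈ L, ∀ a : Fin 8, enc (dec (l.getD a 0)) = l.getD a 0)
    (hinj : ∀ l ∈ L, ∀ a b : Fin 8, l.getD a 0 = l.getD b 0 → a = b)
    (h1 : ∀ i : Fin L.length, ∀ p ∈ sunEdges,
      G.Adj (dec ((L.get i).getD p.1 0)) (dec ((L.get i).getD p.2 0)) ∧
      sunIdx L ((L.get i).getD p.1 0) ((L.get i).getD p.2 0) = i ∧
      sunIdx L ((L.get i).getD p.2 0) ((L.get i).getD p.1 0) = i)
    (h2 : ∀ u v, G.Adj u v → sunIdx L (enc u) (enc v) < L.length) :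
    HasSunletDecomposition G := by
  have key : ∀ (i : Fin L.length) (a b : Fin 8), sunlet8.Adj a b →
      G.Adj (dec ((L.get i).getD a 0)) (dec ((L.get i).getD b 0)) ∧
      sunIdx L ((L.get i).getD a 0) ((L.get i).getD b 0) = i := by
    intro i a b hab
    rcases (sunlet8_adj a b).1 hab with h | h
    · exact ⟨(h1 i _ h).1, (h1 i _ h).2.1⟩
    · exact ⟨(h1 i _ h).1.symm, (h1 i _ h).2.2⟩
  have hed' : ∀ (i j : Fin L.length) (a b : Fin 8),
      dec ((L.get i).getD a 0) = dec ((L.get j).getD b 0) →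
      (L.get i).getD a 0 = (L.get j).getD b 0 := by
    intro i j a b h
    have := congrArg enc h
    rwa [hed _ (L.get_mem i), hed _ (L.get_mem j)] at this
  refine glue G (ι := Fin L.length) (fun _ => sunlet8)
    (fun i (a : Fin 8) => dec ((L.get i).getD a 0)) ?_ (fun _ => sunlet8_dec) ?_ ?_ ?_
  · intro i a b hab
    exact hinj _ (L.get_mem i) a b (hed' i i a b hab)
  · intro i a b hab
    exact (key i a b hab).1
  · intro u v huv
    have hlt := h2 u v huv
    have hh := List.findIdx_getElem (p := sunHas (enc u) (enc v)) (w := hlt)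
    refine ⟨⟨_, hlt⟩, ?_⟩
    simp only [sunHas, List.any_eq_true, Bool.or_eq_true, Bool.and_eq_true, Nat.beq_eq] at hh
    obtain ⟨p, hp, h | h⟩ := hh
    · exact ⟨p.1, p.2, (sunlet8_adj _ _).2 (Or.inl hp),
        (congrArg dec h.1).trans (hde u), (congrArg dec h.2).trans (hde v)⟩
    · exact ⟨p.2, p.1, (sunlet8_adj _ _).2 (Or.inr hp),
        (congrArg dec h.2).trans (hde u), (congrArg dec h.1).trans (hde v)⟩
  · intro i j u v u' v' hi hj e1 e2
    have a1 := (key i u v hi).2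
    have a2 := (key j u' v' hj).2
    rw [hed' _ _ _ _ e1, hed' _ _ _ _ e2, a2] at a1
    exact Fin.ext a1.symm

/-- `K_16` with a star of matchings attached. -/
def starG (s : ℕ) : SimpleGraph (Fin 16 × Fin (s+1)) where
  Adj p q := (p.2 = 0 ∧ q.2 = 0 ∧ p.1 ≠ q.1) ∨ (p.1 = q.1 ∧ p.2 ≠ q.2 ∧ (p.2 = 0 ∨ q.2 = 0))
  symm := ⟨by
    rintro p q (⟨a, b, c⟩ | ⟨a, b, c⟩)
    · exact Or.inl ⟨b, a, c.symm⟩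
    · exact Or.inr ⟨a.symm, b.symm, c.symm⟩⟩
  loopless := ⟨by
    rintro p (⟨a, b, c⟩ | ⟨a, b, c⟩)
    · exact c rfl
    · exact b rfl⟩

instance (s : ℕ) : DecidableRel (starG s).Adj := fun p q =>
  inferInstanceAs (Decidable ((p.2 = 0 ∧ q.2 = 0 ∧ p.1 ≠ q.1) ∨
    (p.1 = q.1 ∧ p.2 ≠ q.2 ∧ (p.2 = 0 ∨ q.2 = 0))))

instance (m n : ℕ) : DecidableRel (completeBipartiteGraph (Fin m) (Fin n)).Adj := fun p q =>
  inferInstanceAs (Decidable ((p.isLeft ∧ q.isRight) ∨ (p.isRight ∧ q.isLeft)))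

def decStar (s k : ℕ) : Fin 16 × Fin (s+1) := (Fin.ofNat 16 k, Fin.ofNat (s+1) (k / 16))

def encStar (s : ℕ) (p : Fin 16 × Fin (s+1)) : ℕ := p.1 + 16 * p.2

def encBip (n : ℕ) : Fin 8 ⊕ Fin (n+1) → ℕ
  | Sum.inl a => a
  | Sum.inr b => b + 8

def decBip (n k : ℕ) : Fin 8 ⊕ Fin (n+1) :=
  if k < 8 then Sum.inl (Fin.ofNat 8 k) else Sum.inr (Fin.ofNat (n+1) (k - 8))

theorem star_0 : HasSunletDecomposition (starG 0) := by
  refine check _ (decStar 0) (encStar 0) [[15,0,9,13,7,2,1,3],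
    [14,12,3,1,4,10,5,8],
    [7,2,10,6,8,4,9,1],
    [9,12,4,5,3,1,6,2],
    [5,14,3,7,6,2,0,1],
    [8,2,11,6,10,1,0,3],
    [8,0,1,5,11,7,4,15],
    [10,15,11,4,5,9,1,8],
    [3,8,13,4,10,12,5,0],
    [12,7,9,2,11,10,14,15],
    [10,0,13,1,11,12,7,15],
    [2,13,11,3,6,10,14,15],
    [14,6,9,8,10,13,11,15],
    [4,7,14,15,9,11,13,12],
    [0,5,12,6,14,11,13,15]] ?_ ?_ ?_ ?_ ?_ <;> decide +kernel

theorem star_1 : HasSunletDecomposition (starG 1) := by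
  refine check _ (decStar 1) (encStar 1) [[12,5,13,15,9,7,0,6],
    [0,10,14,2,11,7,1,6],
    [7,6,4,11,0,5,2,1],
    [11,3,1,8,10,6,4,5],
    [10,15,9,6,8,11,1,0],
    [5,2,7,14,0,10,1,8],
    [1,0,4,10,6,15,5,26],
    [12,8,9,3,10,7,5,15],
    [2,11,5,1,12,14,10,15],
    [3,13,9,4,8,12,10,7],
    [0,14,6,8,12,3,11,15],
    [5,3,7,15,21,10,12,14],
    [1,12,14,13,17,11,30,8],
    [4,12,6,13,14,28,22,10],
    [9,7,13,11,14,23,29,27],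
    [3,0,9,2,19,16,25,13],
    [4,8,2,15,20,24,18,31]] ?_ ?_ ?_ ?_ ?_ <;> decide +kernel

theorem star_2 : HasSunletDecomposition (starG 2) := by
  refine check _ (decStar 2) (encStar 2) [[3,0,14,10,7,6,13,9],
    [13,11,1,12,7,4,6,15],
    [2,7,6,8,4,9,3,5],
    [15,3,14,7,0,13,9,12],
    [1,5,4,9,2,10,8,3],
    [11,12,6,15,7,2,9,1],
    [10,0,9,2,1,7,5,13],
    [9,8,15,13,25,7,31,0],
    [4,6,5,7,15,10,11,23],
    [4,13,5,3,14,29,15,11],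
    [11,0,1,14,8,12,13,15],
    [12,14,8,10,9,30,13,15],
    [2,3,8,0,14,19,24,16],
    [4,10,7,1,20,26,39,17],
    [15,9,11,2,47,41,27,18],
    [6,2,5,14,22,34,21,46],
    [1,3,12,8,33,35,28,40],
    [6,13,10,11,38,45,42,43],
    [4,0,5,12,36,32,37,44]] ?_ ?_ ?_ ?_ ?_ <;> decide +kernel

theorem star_3 : HasSunletDecomposition (starG 3) := by
  refine check _ (decStar 3) (encStar 3) [[13,0,2,10,5,9,4,6],
    [4,14,15,7,3,6,13,0],
    [1,6,12,5,2,0,11,7],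
    [12,9,11,8,4,3,5,0],
    [5,0,11,3,2,4,13,7],
    [8,1,7,6,2,9,12,5],
    [9,15,4,10,6,12,13,11],
    [13,3,14,9,12,15,7,25],
    [14,2,3,0,11,9,19,16],
    [1,13,6,11,15,29,22,27],
    [9,5,4,8,41,21,20,3],
    [12,10,7,2,28,15,23,18],
    [7,8,14,13,39,24,30,45],
    [10,0,15,5,26,32,31,37],
    [4,6,3,1,36,38,35,17],
    [12,1,10,3,44,33,42,51],
    [15,11,2,6,47,43,34,54],
    [11,4,9,7,59,52,57,55],
    [13,8,15,2,61,40,63,50],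
    [5,14,10,8,53,46,58,56],
    [14,1,0,12,62,49,48,60]] ?_ ?_ ?_ ?_ ?_ <;> decide +kernel

theorem star_4 : HasSunletDecomposition (starG 4) := by
  refine check _ (decStar 4) (encStar 4) [[12,8,2,10,76,72,66,74],
    [11,1,4,14,75,65,68,78],
    [7,13,0,15,71,77,64,79],
    [10,15,3,9,58,63,67,73],
    [6,9,5,12,70,57,69,60],
    [8,14,0,5,56,62,48,53],
    [11,6,13,3,59,54,61,51],
    [8,4,2,7,40,52,50,55],
    [6,10,1,0,38,42,49,32],
    [7,9,14,12,39,41,46,44],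
    [3,2,13,1,35,34,45,33],
    [11,5,4,15,43,37,36,47],
    [9,15,13,8,25,31,29,24],
    [4,12,0,3,20,28,16,19],
    [6,15,1,5,22,12,17,21],
    [14,7,11,2,30,23,27,18],
    [7,10,13,5,6,26,11,3],
    [14,3,12,1,5,7,9,6],
    [9,11,4,0,1,10,13,7],
    [6,8,10,4,3,11,0,7],
    [0,2,1,8,11,15,7,3],
    [9,2,12,13,4,6,11,14],
    [10,14,15,5,3,6,8,2]] ?_ ?_ ?_ ?_ ?_ <;> decide +kernel

theorem bip_4 : HasSunletDecomposition (completeBipartiteGraph (Fin 8) (Fin 4)) := by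
  refine check _ (decBip 3) (encBip 3) [[2,11,3,8,9,1,10,5],
    [7,9,1,10,11,0,8,2],
    [5,10,6,9,11,4,8,3],
    [4,8,0,11,9,7,10,6]] ?_ ?_ ?_ ?_ ?_ <;> decide +kernel

theorem bip_6 : HasSunletDecomposition (completeBipartiteGraph (Fin 8) (Fin 6)) := by
  refine check _ (decBip 5) (encBip 5) [[3,8,1,10,13,7,12,6],
    [2,13,4,12,10,6,9,7],
    [4,11,5,10,8,6,12,7],
    [0,9,3,12,10,7,11,6],
    [5,8,0,13,9,6,11,7],
    [2,9,1,11,8,6,13,7]] ?_ ?_ ?_ ?_ ?_ <;> decide +kernel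

theorem bip_7 : HasSunletDecomposition (completeBipartiteGraph (Fin 8) (Fin 7)) := by
  refine check _ (decBip 6) (encBip 6) [[5,14,6,10,8,1,9,0],
    [6,13,2,12,8,0,10,1],
    [3,8,0,14,9,1,11,4],
    [7,11,1,9,12,3,13,0],
    [5,13,3,12,11,7,10,0],
    [7,8,4,10,14,2,12,1],
    [2,9,4,11,14,5,13,6]] ?_ ?_ ?_ ?_ ?_ <;> decide +kernel

theorem bip_9 : HasSunletDecomposition (completeBipartiteGraph (Fin 8) (Fin 9)) := by
  refine check _ (decBip 8) (encBip 8) [[1,14,2,11,16,0,13,3],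
    [3,16,0,10,12,2,9,4],
    [6,13,7,11,10,0,8,5],
    [0,12,1,8,11,2,13,3],
    [6,9,5,16,14,3,10,4],
    [5,12,4,15,14,7,11,0],
    [3,14,4,13,15,7,8,5],
    [2,8,6,15,9,5,12,7],
    [1,9,7,10,15,4,16,2]] ?_ ?_ ?_ ?_ ?_ <;> decide +kernel

/-- The pairs not oriented by `out`. -/
def restG (r : ℕ) (out : Fin r → List (Fin r)) : SimpleGraph (Fin r) where
  Adj a b := a ≠ b ∧ b ∉ out a ∧ a ∉ out b
  symm := ⟨fun _ _ h => ⟨h.1.symm, h.2.2, h.2.1⟩⟩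
  loopless := ⟨fun _ h => h.1 rfl⟩

instance (r : ℕ) (out : Fin r → List (Fin r)) : DecidableRel (restG r out).Adj := fun a b =>
  inferInstanceAs (Decidable (a ≠ b ∧ b ∉ out a ∧ a ∉ out b))

/-- `K_m □ K_n` has a decomposition. -/
def QD (m n : ℕ) : Prop :=
  HasSunletDecomposition ((⊤ : SimpleGraph (Fin m)) □ (⊤ : SimpleGraph (Fin n)))

/-- `K_{m,n}` has a decomposition. -/
def BD (m n : ℕ) : Prop := HasSunletDecomposition (completeBipartiteGraph (Fin m) (Fin n))

theorem star_all (s : ℕ) (hs : s ≤ 4) : HasSunletDecomposition (starG s) := by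
  interval_cases s
  · exact star_0
  · exact star_1
  · exact star_2
  · exact star_3
  · exact star_4

theorem base (r : ℕ) (out : Fin r → List (Fin r))
    (hlen : ∀ a, (out a).length ≤ 4) (hnd : ∀ a, (a :: out a).Nodup)
    (hasym : ∀ a, ∀ b ∈ out a, a ∉ out b)
    (hC : HasSunletDecomposition (restG r out)) : QD 16 r := by
  have hget : ∀ a (j : Fin ((out a).length + 1)), j ≠ 0 → (a :: out a).get j ∈ out a := by
    intro a j hj
    obtain ⟨k, rfl⟩ := Fin.exists_succ_eq.2 hj
    simp
  have hna : ∀ a, a ∉ out a := fun a => (List.nodup_cons.1 (hnd a)).1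
  refine glue _ (ι := Fin r ⊕ Fin 16)
    (U := fun i => Sum.elim (fun a => Fin 16 × Fin ((out a).length + 1)) (fun _ => Fin r) i)
    (fun i => match i with
      | Sum.inl a => starG (out a).length
      | Sum.inr _ => restG r out)
    (fun i => match i with
      | Sum.inl a => fun p => (p.1, (a :: out a).get p.2)
      | Sum.inr x => fun b => (x, b)) ?_ ?_ ?_ ?_ ?_
  · rintro (a | x)
    · rintro ⟨x, j⟩ ⟨y, k⟩ h
      simp only [Prod.mk.injEq] at h
      obtain ⟨h1, h2⟩ := h
      have := List.nodup_iff_injective_get.1 (hnd a) h2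
      subst h1
      subst this
      rfl
    · intro b c h
      exact (Prod.mk.inj h).2
  · rintro (a | x)
    · exact star_all _ (hlen a)
    · exact hC
  · rintro (a | x)
    · rintro ⟨x, j⟩ ⟨y, k⟩ (⟨h1, h2, h3⟩ | ⟨h1, h2, h3⟩)
      · simp only at h1 h2 h3
        subst h1 h2
        simp [SimpleGraph.boxProd_adj, h3]
      · simp only at h1 h2 h3
        subst h1
        have : (a :: out a).get j ≠ (a :: out a).get k := fun h =>
          h2 (List.nodup_iff_injective_get.1 (hnd a) h)
        rw [SimpleGraph.boxProd_adj]
        exact Or.inr ⟨this, rfl⟩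
    · intro b c h
      rw [SimpleGraph.boxProd_adj]
      exact Or.inr ⟨h.1, rfl⟩
  · rintro ⟨x, b⟩ ⟨y, c⟩ h
    rw [SimpleGraph.boxProd_adj] at h
    rcases h with ⟨h1, h2⟩ | ⟨h1, h2⟩
    · simp only [SimpleGraph.top_adj] at h1 h2
      subst h2
      exact ⟨Sum.inl b, (x, 0), (y, 0), Or.inl ⟨rfl, rfl, h1⟩, rfl, rfl⟩
    · simp only [SimpleGraph.top_adj] at h1 h2
      subst h2
      by_cases hc : c ∈ out b
      · obtain ⟨k, hk⟩ := List.mem_iff_get.1 hc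
        exact ⟨Sum.inl b, (x, 0), (x, k.succ),
          Or.inr ⟨rfl, (Fin.succ_ne_zero k).symm, Or.inl rfl⟩, rfl, Prod.ext rfl hk⟩
      · by_cases hb : b ∈ out c
        · obtain ⟨k, hk⟩ := List.mem_iff_get.1 hb
          exact ⟨Sum.inl c, (x, k.succ), (x, 0),
            Or.inr ⟨rfl, Fin.succ_ne_zero k, Or.inr rfl⟩, Prod.ext rfl hk, rfl⟩
        · exact ⟨Sum.inr x, b, c, ⟨h1, hc, hb⟩, rfl, rfl⟩
  · have key : ∀ a x y (j k : Fin ((out a).length + 1)), (starG (out a).length).Adj (x, j) (y, k) →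
        (x ≠ y ∧ (a :: out a).get j = a ∧ (a :: out a).get k = a) ∨
        (x = y ∧ (a :: out a).get j = a ∧ (a :: out a).get k ∈ out a) ∨
        (x = y ∧ (a :: out a).get k = a ∧ (a :: out a).get j ∈ out a) := by
      rintro a x y j k (⟨h1, h2, h3⟩ | ⟨h1, h2, h3 | h3⟩)
      · simp only at h1 h2 h3
        subst h1 h2
        exact Or.inl ⟨h3, rfl, rfl⟩
      · simp only at h1 h2 h3
        subst h1 h3
        exact Or.inr (Or.inl ⟨rfl, rfl, hget _ _ h2.symm⟩)
      · simp only at h1 h2 h3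
        subst h1 h3
        exact Or.inr (Or.inr ⟨rfl, rfl, hget _ _ h2⟩)
    rintro (a | x) (a' | x')
    · rintro ⟨x, j⟩ ⟨y, k⟩ ⟨x', j'⟩ ⟨y', k'⟩ h h' e e'
      have h := key _ _ _ _ _ h
      have h' := key _ _ _ _ _ h'
      simp only [Prod.mk.injEq] at e e'
      obtain ⟨rfl, e⟩ := e
      obtain ⟨rfl, e'⟩ := e'
      rw [← e, ← e'] at h'
      congr 1
      grind
    · rintro ⟨x, j⟩ ⟨y, k⟩ b c h h' e e'
      have h := key _ _ _ _ _ h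
      have h' : b ≠ c ∧ c ∉ out b ∧ b ∉ out c := h'
      simp only at e e'
      exfalso
      grind
    · rintro b c ⟨x, j⟩ ⟨y, k⟩ h' h e e'
      have h := key _ _ _ _ _ h
      have h' : b ≠ c ∧ c ∉ out b ∧ b ∉ out c := h'
      simp only at e e'
      exfalso
      grind
    · intro b c b' c' h h' e e'
      rw [(Prod.mk.inj e).1]

theorem base_1 : QD 16 1 := by
  refine base 1 ![[]] (by decide) (by decide) (by decide) ?_
  refine check _ (Fin.ofNat 1) Fin.val [] ?_ ?_ ?_ ?_ ?_ <;> decide +kernel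

theorem base_2 : QD 16 2 := by
  refine base 2 ![[1], []] (by decide) (by decide) (by decide) ?_
  refine check _ (Fin.ofNat 2) Fin.val [] ?_ ?_ ?_ ?_ ?_ <;> decide +kernel

theorem base_3 : QD 16 3 := by
  refine base 3 ![[1], [2], [0]] (by decide) (by decide) (by decide) ?_
  refine check _ (Fin.ofNat 3) Fin.val [] ?_ ?_ ?_ ?_ ?_ <;> decide +kernel

theorem base_4 : QD 16 4 := by
  refine base 4 ![[1, 2], [3, 2], [3], [0]] (by decide) (by decide) (by decide) ?_
  refine check _ (Fin.ofNat 4) Fin.val [] ?_ ?_ ?_ ?_ ?_ <;> decide +kernel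

theorem base_5 : QD 16 5 := by
  refine base 5 ![[3, 1, 2], [2, 3], [3, 4], [4], [0, 1]] (by decide) (by decide) (by decide) ?_
  refine check _ (Fin.ofNat 5) Fin.val [] ?_ ?_ ?_ ?_ ?_ <;> decide +kernel

theorem base_6 : QD 16 6 := by
  refine base 6 ![[1, 3, 2], [3, 4, 2], [4, 5], [4, 2], [5, 0], [1, 3, 0]] (by decide) (by decide) (by decide) ?_
  refine check _ (Fin.ofNat 6) Fin.val [] ?_ ?_ ?_ ?_ ?_ <;> decide +kernel

theorem base_7 : QD 16 7 := by
  refine base 7 ![[5, 2, 4], [0, 6, 2], [3, 4], [6, 0, 1, 4], [1, 5, 6], [6, 2, 1, 3], [2, 0]] (by decide) (by decide) (by decide) ?_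
  refine check _ (Fin.ofNat 7) Fin.val [] ?_ ?_ ?_ ?_ ?_ <;> decide +kernel

theorem base_8 : QD 16 8 := by
  refine base 8 ![[3, 2, 1], [5, 2, 3], [6, 4, 3, 7], [4, 7, 5], [1, 6, 0, 5], [2, 0, 6], [0, 3, 1, 7], [1, 5, 0, 4]] (by decide) (by decide) (by decide) ?_
  refine check _ (Fin.ofNat 8) Fin.val [] ?_ ?_ ?_ ?_ ?_ <;> decide +kernel

theorem base_9 : QD 16 9 := by
  refine base 9 ![[2, 5, 1, 8], [6, 4, 2, 7], [3, 4, 5, 6], [8, 1, 0, 4], [5, 7, 0, 6], [1, 7, 6, 3], [0, 7, 3, 8], [8, 2, 0, 3], [4, 5, 1, 2]] (by decide) (by decide) (by decide) ?_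
  refine check _ (Fin.ofNat 9) Fin.val [] ?_ ?_ ?_ ?_ ?_ <;> decide +kernel

theorem base_10 : QD 16 10 := by
  refine base 10 ![[3, 2, 1, 4], [4, 6, 7, 3], [7, 4, 1, 9], [5, 6, 8, 2], [3, 5, 7, 9], [7, 8, 0, 2], [2, 4, 9, 7], [3, 0, 8], [1, 0, 4], [1, 0, 7]] (by decide) (by decide) (by decide) ?_
  refine check _ (Fin.ofNat 10) Fin.val [[5,6,8,9,1,0,2,3]] ?_ ?_ ?_ ?_ ?_ <;> decide +kernel

theorem base_11 : QD 16 11 := by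
  refine base 11 ![[4, 6, 1, 2], [2, 5, 7, 8], [9, 3, 4, 6], [0, 4, 5], [5, 1, 8, 6], [10, 6, 8], [7, 3, 1], [2, 10, 0, 9], [6, 3, 10], [4, 1, 6, 10], [3, 4, 1]] (by decide) (by decide) (by decide) ?_
  refine check _ (Fin.ofNat 11) Fin.val [[9,3,7,5,8,1,4,0],
    [8,0,10,2,7,9,6,5]] ?_ ?_ ?_ ?_ ?_ <;> decide +kernel

theorem base_13 : QD 16 13 := by
  refine base 13 ![[9, 8, 1, 5], [8, 3, 4], [12, 4, 7, 10], [2, 0, 4, 10], [7, 6, 0], [6, 4, 1, 7], [12, 8, 0], [10, 0, 12, 3], [11, 7, 5, 10], [4, 1, 8, 10], [4, 11, 5], [6, 4, 12], [10, 3, 4]] (by decide) (by decide) (by decide) ?_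
  refine check _ (Fin.ofNat 13) Fin.val [[8,2,11,3,4,1,9,5],
    [10,6,2,0,1,3,5,12],
    [1,6,9,12,11,7,3,8],
    [7,9,5,11,1,2,12,0]] ?_ ?_ ?_ ?_ ?_ <;> decide +kernel

theorem BD_comm {m n : ℕ} (h : BD m n) : BD n m := by
  refine dec_iso (G := completeBipartiteGraph (Fin m) (Fin n)) ⟨Equiv.sumComm _ _, ?_⟩ h
  intro a b
  rcases a with a | a <;> rcases b with b | b <;> simp

theorem QD_comm {m n : ℕ} (h : QD m n) : QD n m :=
  dec_iso (SimpleGraph.boxProdComm _ _) h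

theorem BD_add {m n p : ℕ} (h1 : BD p m) (h2 : BD p n) : BD p (m + n) := by
  have : HasSunletDecomposition (completeBipartiteGraph (Fin p) (Fin m ⊕ Fin n)) := by
    refine glue _ (ι := Bool)
      (U := fun i => bif i then Fin p ⊕ Fin m else Fin p ⊕ Fin n)
      (fun i => match i with
        | true => completeBipartiteGraph (Fin p) (Fin m)
        | false => completeBipartiteGraph (Fin p) (Fin n))
      (fun i => match i with
        | true => Sum.map id Sum.inl
        | false => Sum.map id Sum.inr) ?_ ?_ ?_ ?_ ?_
    · rintro (_ | _)
      · exact Sum.map_injective.2 ⟨Function.injective_id, Sum.inr_injective⟩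
      · exact Sum.map_injective.2 ⟨Function.injective_id, Sum.inl_injective⟩
    · rintro (_ | _)
      · exact h2
      · exact h1
    · rintro (_ | _) (u | u) (v | v) h <;> simp_all
    · rintro (u | u | u) (v | v | v) h
      all_goals first
        | (exfalso; simp at h; done)
        | exact ⟨true, Sum.inl u, Sum.inr v, by simp, rfl, rfl⟩
        | exact ⟨false, Sum.inl u, Sum.inr v, by simp, rfl, rfl⟩
        | exact ⟨true, Sum.inr u, Sum.inl v, by simp, rfl, rfl⟩
        | exact ⟨false, Sum.inr u, Sum.inl v, by simp, rfl, rfl⟩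
    · rintro (_ | _) (_ | _) (u | u) (v | v) (u' | u') (v' | v') h h' e e' <;> simp_all
  refine dec_iso (G := completeBipartiteGraph (Fin p) (Fin m ⊕ Fin n))
    ⟨Equiv.sumCongr (Equiv.refl _) finSumFinEquiv, ?_⟩ this
  intro a b
  rcases a with a | a <;> rcases b with b | b <;> simp

theorem QD_add {m n p : ℕ} (h1 : QD p m) (h2 : QD p n) (h3 : BD m n) : QD p (m + n) := by
  have : HasSunletDecomposition
      ((⊤ : SimpleGraph (Fin p)) □ (⊤ : SimpleGraph (Fin m ⊕ Fin n))) := by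
    refine glue _ (ι := Bool ⊕ Fin p)
      (U := fun i => Sum.elim (fun b => bif b then Fin p × Fin m else Fin p × Fin n)
        (fun _ => Fin m ⊕ Fin n) i)
      (fun i => match i with
        | Sum.inl true => (⊤ : SimpleGraph (Fin p)) □ (⊤ : SimpleGraph (Fin m))
        | Sum.inl false => (⊤ : SimpleGraph (Fin p)) □ (⊤ : SimpleGraph (Fin n))
        | Sum.inr _ => completeBipartiteGraph (Fin m) (Fin n))
      (fun i => match i with
        | Sum.inl true => Prod.map id Sum.inl
        | Sum.inl false => Prod.map id Sum.inr
        | Sum.inr x => fun w => (x, w)) ?_ ?_ ?_ ?_ ?_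
    · rintro ((_ | _) | x)
      · exact Function.Injective.prodMap Function.injective_id Sum.inr_injective
      · exact Function.Injective.prodMap Function.injective_id Sum.inl_injective
      · intro b c h
        exact (Prod.mk.inj h).2
    · rintro ((_ | _) | x)
      · exact h2
      · exact h1
      · exact h3
    · rintro ((_ | _) | x)
      · rintro ⟨x, a⟩ ⟨y, b⟩ h
        simpa [SimpleGraph.boxProd_adj] using h
      · rintro ⟨x, a⟩ ⟨y, b⟩ h
        simpa [SimpleGraph.boxProd_adj] using h
      · rintro (a | a) (b | b) h <;> simp_all [SimpleGraph.boxProd_adj]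
    · rintro ⟨x, a⟩ ⟨y, b⟩ h
      rcases a with a | a <;> rcases b with b | b
      · exact ⟨Sum.inl true, (x, a), (y, b), by simpa [SimpleGraph.boxProd_adj] using h, rfl, rfl⟩
      · have : x = y := by simpa [SimpleGraph.boxProd_adj] using h
        subst this
        exact ⟨Sum.inr x, Sum.inl a, Sum.inr b, by simp, rfl, rfl⟩
      · have : x = y := by simpa [SimpleGraph.boxProd_adj] using h
        subst this
        exact ⟨Sum.inr x, Sum.inr a, Sum.inl b, by simp, rfl, rfl⟩
      · exact ⟨Sum.inl false, (x, a), (y, b), by simpa [SimpleGraph.boxProd_adj] using h, rfl, rfl⟩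
    · rintro ((_ | _) | x) ((_ | _) | x')
      · intros; rfl
      · rintro ⟨x, a⟩ ⟨y, b⟩ ⟨x', a'⟩ ⟨y', b'⟩ h h' e e'
        simp at e
      · rintro ⟨x, a⟩ ⟨y, b⟩ (a' | a') (b' | b') h h' e e' <;> simp_all
      · rintro ⟨x, a⟩ ⟨y, b⟩ ⟨x', a'⟩ ⟨y', b'⟩ h h' e e'
        simp at e
      · intros; rfl
      · rintro ⟨x, a⟩ ⟨y, b⟩ (a' | a') (b' | b') h h' e e' <;> simp_all
      · rintro (a' | a') (b' | b') ⟨x, a⟩ ⟨y, b⟩ h h' e e' <;> simp_all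
      · rintro (a' | a') (b' | b') ⟨x, a⟩ ⟨y, b⟩ h h' e e' <;> simp_all
      · intro b c b' c' h h' e e'
        rw [(Prod.mk.inj e).1]
  refine dec_iso (G := (⊤ : SimpleGraph (Fin p)) □ (⊤ : SimpleGraph (Fin m ⊕ Fin n)))
    ⟨Equiv.prodCongr (Equiv.refl _) finSumFinEquiv, ?_⟩ this
  rintro ⟨x, a⟩ ⟨y, b⟩
  simp [SimpleGraph.boxProd_adj]

theorem BD8 (n : ℕ) (h4 : 4 ≤ n) (h5 : n ≠ 5) : BD 8 n := by
  induction n using Nat.strong_induction_on with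
  | _ n ih =>
    by_cases h : n = 4 ∨ n = 6 ∨ n = 7 ∨ n = 9
    · rcases h with rfl | rfl | rfl | rfl
      · exact bip_4
      · exact bip_6
      · exact bip_7
      · exact bip_9
    · obtain ⟨k, rfl⟩ : ∃ k, n = k + 4 := ⟨n - 4, by omega⟩
      exact BD_add (ih k (by omega) (by omega) (by omega)) bip_4

theorem QD16 (n : ℕ) (hn : 0 < n) : QD 16 n := by
  induction n using Nat.strong_induction_on with
  | _ n ih =>
    by_cases h : n ≤ 11 ∨ n = 13
    · have h : n = 1 ∨ n = 2 ∨ n = 3 ∨ n = 4 ∨ n = 5 ∨ n = 6 ∨ n = 7 ∨ n = 8 ∨ n = 9 ∨ n = 10 ∨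
        n = 11 ∨ n = 13 := by omega
      rcases h with rfl | rfl | rfl | rfl | rfl | rfl | rfl | rfl | rfl | rfl | rfl | rfl
      exacts [base_1, base_2, base_3, base_4, base_5, base_6, base_7, base_8, base_9, base_10,
        base_11, base_13]
    · obtain ⟨k, rfl⟩ : ∃ k, n = k + 8 := ⟨n - 8, by omega⟩
      exact QD_add (ih k (by omega) (by omega)) base_8 (BD_comm (BD8 k (by omega) (by omega)))

theorem stmt_3 (m n : ℕ) (hm : 0 < m) (hn : 0 < n) (h1 : m % 16 = 0) :
    HasSunletDecomposition ((⊤ : SimpleGraph (Fin m)) □ (⊤ : SimpleGraph (Fin n))) := by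
  obtain ⟨k, rfl⟩ : ∃ k, m = 16 * (k + 1) := ⟨m / 16 - 1, by omega⟩
  clear hm h1
  change QD _ _
  induction k with
  | zero => exact QD16 n hn
  | succ k ih =>
    have hb : BD (16 * (k + 1)) 16 := by
      have := BD_comm (BD8 (16 * (k + 1)) (by omega) (by omega))
      exact BD_add this this
    exact QD_comm (QD_add (QD_comm ih) (QD_comm (QD16 n hn)) hb)
end

section
/- If m and n are positive integers with m ≡ 11 (mod 16) and n ≡ 7 (mod 16), then the graph K_m □ K_n has an L_8-decomposition. -/
open SimpleGraph

/-- A list of eight natural numbers, the vertices of a sunlet. -/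
structure Pc where
  a : ℕ
  b : ℕ
  c : ℕ
  d : ℕ
  e : ℕ
  f : ℕ
  g : ℕ
  h : ℕ

namespace Pc

def fn (p : Pc) : Fin 8 → ℕ := ![p.a, p.b, p.c, p.d, p.e, p.f, p.g, p.h]

def verts (p : Pc) : List ℕ := [p.a, p.b, p.c, p.d, p.e, p.f, p.g, p.h]

def darts (p : Pc) : List (ℕ × ℕ) :=
  [(p.a, p.b), (p.b, p.c), (p.c, p.d), (p.d, p.a),
   (p.a, p.e), (p.b, p.f), (p.c, p.g), (p.d, p.h),
   (p.b, p.a), (p.c, p.b), (p.d, p.c), (p.a, p.d),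
   (p.e, p.a), (p.f, p.b), (p.g, p.c), (p.h, p.d)]

def map (k : ℕ → ℕ) (p : Pc) : Pc :=
  ⟨k p.a, k p.b, k p.c, k p.d, k p.e, k p.f, k p.g, k p.h⟩

end Pc

def nodupB : List ℕ → Bool
  | [] => true
  | x :: l => l.all (fun y => !(Nat.beq x y)) && nodupB l

lemma nodupB_spec (l : List ℕ) (h : nodupB l = true) : l.Nodup := by
  induction l with
  | nil => simp
  | cons x l ih =>
    simp only [nodupB, Bool.and_eq_true, List.all_eq_true] at h
    refine List.nodup_cons.2 ⟨fun hx => ?_, ih h.2⟩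
    have := h.1 x hx
    simp at this

/-- evaluate a number before using it -/
def force {α : Type} (n : ℕ) (f : ℕ → α) : α :=
  Nat.rec (f 0) (fun k _ => f (k + 1)) n

lemma force_eq {α : Type} (n : ℕ) (f : ℕ → α) : force n f = f n := by
  cases n <;> rfl

/-- insert all codes into the bit set `acc`, failing (value `0`) on repetition -/
def ins : List ℕ → ℕ → ℕ
  | [], acc => acc
  | x :: l, acc => bif Nat.beq (Nat.land (Nat.shiftRight acc x) 1) 0 then
      force (Nat.lor acc (Nat.shiftLeft 1 x)) (ins l) else 0

lemma tb (acc x : ℕ) : Nat.beq (Nat.land (Nat.shiftRight acc x) 1) 0 = !(acc.testBit x) := by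
  have : Nat.land (Nat.shiftRight acc x) 1 = (acc >>> x) &&& 1 := rfl
  rw [this, Nat.testBit, Nat.land_comm]
  rcases h : 1 &&& (acc >>> x) with _ | k <;> simp [Nat.beq]

lemma ins_spec (l : List ℕ) : ∀ acc : ℕ, ins l acc ≠ 0 →
    l.Nodup ∧ (∀ x ∈ l, acc.testBit x = false) ∧
    ∀ x, (ins l acc).testBit x = true → acc.testBit x = true ∨ x ∈ l := by
  induction l with
  | nil => intro acc _; simp [ins]
  | cons x l ih =>
    intro acc h
    simp only [ins, tb, force_eq] at h ⊢
    cases hb : acc.testBit x with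
    | true => simp [hb] at h
    | false =>
      simp only [hb, Bool.not_false, cond_true] at h ⊢
      obtain ⟨h1, h2, h3⟩ := ih _ h
      have key : ∀ y, (Nat.lor acc (Nat.shiftLeft 1 x)).testBit y
          = (acc.testBit y || decide (x = y)) := by
        intro y
        have : Nat.lor acc (Nat.shiftLeft 1 x) = acc ||| (1 <<< x) := rfl
        rw [this, Nat.testBit_or, Nat.one_shiftLeft, Nat.testBit_two_pow]
      refine ⟨List.nodup_cons.2 ⟨fun hx => ?_, h1⟩, ?_, ?_⟩
      · have := h2 x hx
        rw [key] at this
        simp at this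
      · intro y hy
        rcases List.mem_cons.1 hy with rfl | hy
        · exact hb
        · have := h2 y hy
          rw [key] at this
          simp only [Bool.or_eq_false_iff] at this
          exact this.1
      · intro y hy
        rcases h3 y hy with h | h
        · rw [key] at h
          simp only [Bool.or_eq_true, decide_eq_true_eq] at h
          rcases h with h | h
          · exact Or.inl h
          · exact Or.inr (by simp [h])
        · exact Or.inr (by simp [h])

def codes (N : ℕ) (p : Pc) : List ℕ := p.darts.map (fun d => d.1 * N + d.2)

/-- the checker -/
def chk (N : ℕ) (adj : ℕ → ℕ → Bool) (L : List Pc) : Bool :=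
  L.all (fun p => nodupB p.verts && p.verts.all (fun v => Nat.blt v N) &&
    p.darts.all (fun d => adj d.1 d.2)) &&
  force (ins (L.flatMap (codes N)) 0) (fun M => !(Nat.beq M 0) &&
    (List.range N).all (fun u => (List.range N).all (fun v =>
      !(adj u v) || !(Nat.beq (Nat.land (Nat.shiftRight M (u * N + v)) 1) 0))))

lemma fn_inj (p : Pc) (h : p.verts.Nodup) : Function.Injective p.fn := by
  have : p.verts = List.ofFn p.fn := by
    simp [Pc.verts, Pc.fn, List.ofFn_succ]
  rw [this] at h
  exact List.nodup_ofFn.1 h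

lemma sun_darts (p : Pc) (u v : ℕ) :
    (u, v) ∈ p.darts ↔ ∃ i j : Fin 8, sunlet8.Adj i j ∧ p.fn i = u ∧ p.fn j = v := by
  constructor
  · intro h
    simp only [Pc.darts, List.mem_cons, List.not_mem_nil, or_false, Prod.mk.injEq] at h
    have A : ∀ i j : Fin 8, (sunlet8.Adj i j ∧ p.fn i = u ∧ p.fn j = v) →
      ∃ i j : Fin 8, sunlet8.Adj i j ∧ p.fn i = u ∧ p.fn j = v := fun i j h => ⟨i, j, h⟩
    rcases h with h | h | h | h | h | h | h | h | h | h | h | h | h | h | h | h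
    · exact A 0 1 ⟨by simp [sunlet8], h.1.symm, h.2.symm⟩
    · exact A 1 2 ⟨by simp [sunlet8], h.1.symm, h.2.symm⟩
    · exact A 2 3 ⟨by simp [sunlet8], h.1.symm, h.2.symm⟩
    · exact A 3 0 ⟨by simp [sunlet8], h.1.symm, h.2.symm⟩
    · exact A 0 4 ⟨by simp [sunlet8], h.1.symm, h.2.symm⟩
    · exact A 1 5 ⟨by simp [sunlet8], h.1.symm, h.2.symm⟩
    · exact A 2 6 ⟨by simp [sunlet8], h.1.symm, h.2.symm⟩
    · exact A 3 7 ⟨by simp [sunlet8], h.1.symm, h.2.symm⟩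
    · exact A 1 0 ⟨by simp [sunlet8], h.1.symm, h.2.symm⟩
    · exact A 2 1 ⟨by simp [sunlet8], h.1.symm, h.2.symm⟩
    · exact A 3 2 ⟨by simp [sunlet8], h.1.symm, h.2.symm⟩
    · exact A 0 3 ⟨by simp [sunlet8], h.1.symm, h.2.symm⟩
    · exact A 4 0 ⟨by simp [sunlet8], h.1.symm, h.2.symm⟩
    · exact A 5 1 ⟨by simp [sunlet8], h.1.symm, h.2.symm⟩
    · exact A 6 2 ⟨by simp [sunlet8], h.1.symm, h.2.symm⟩
    · exact A 7 3 ⟨by simp [sunlet8], h.1.symm, h.2.symm⟩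
  · rintro ⟨i, j, hij, rfl, rfl⟩
    fin_cases i <;> fin_cases j <;>
      first
      | (exfalso; revert hij; simp [sunlet8]; done)
      | simp [Pc.darts, Pc.fn]

theorem chk_spec (N : ℕ) (adj : ℕ → ℕ → Bool) (L : List Pc) (h : chk N adj L = true)
    (G : SimpleGraph (Fin N)) (hG : ∀ u v : Fin N, G.Adj u v ↔ adj u v = true) :
    HasSunletDecomposition G := by
  simp only [chk, force_eq, Bool.and_eq_true, List.all_eq_true, tb, Bool.not_not, Bool.or_eq_true,
    List.mem_range, Bool.not_eq_true', Nat.blt_eq] at h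
  obtain ⟨h1, h2, h3⟩ := h
  have h2' : ins (L.flatMap (codes N)) 0 ≠ 0 := fun h => by rw [h] at h2; simp at h2
  obtain ⟨k1, -, k3⟩ := ins_spec _ _ h2'
  have hlt : ∀ p ∈ L, ∀ i, p.fn i < N := by
    intro p hp i
    apply (h1 p hp).1.2
    fin_cases i <;> simp [Pc.fn, Pc.verts]
  let F : (p : Pc) → p ∈ L → Fin 8 → Fin N := fun p hp i => ⟨p.fn i, hlt p hp i⟩
  have hmem : ∀ p (hp : p ∈ L) (u v : Fin N),
      s(u, v) ∈ Sym2.map (F p hp) '' sunlet8.edgeSet ↔ (u.1, v.1) ∈ p.darts := by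
    intro p hp u v
    rw [sun_darts]
    constructor
    · rintro ⟨e, he, hh⟩
      induction e with | _ i j =>
      rw [SimpleGraph.mem_edgeSet] at he
      rw [Sym2.map_mk, Sym2.eq_iff] at hh
      rcases hh with ⟨rfl, rfl⟩ | ⟨rfl, rfl⟩
      · exact ⟨i, j, he, rfl, rfl⟩
      · exact ⟨j, i, he.symm, rfl, rfl⟩
    · rintro ⟨i, j, hij, hu, hv⟩
      refine ⟨s(i, j), hij, ?_⟩
      rw [Sym2.map_mk, Sym2.eq_iff]
      exact Or.inl ⟨Fin.ext hu, Fin.ext hv⟩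
  refine ⟨{s | ∃ p, ∃ hp : p ∈ L, s = Sym2.map (F p hp) '' sunlet8.edgeSet}, ?_, ?_, ?_⟩
  · ext e
    induction e with | _ u v =>
    rw [SimpleGraph.mem_edgeSet, hG, Set.mem_sUnion]
    constructor
    · rintro ⟨s, ⟨p, hp, rfl⟩, he⟩
      rw [hmem p hp] at he
      exact (h1 p hp).2 _ he
    · intro ha
      have hM := (h3 u u.2 v v.2).resolve_left (by simp [ha])
      have hc := (k3 _ hM).resolve_left (by simp)
      obtain ⟨p, hp, hc⟩ := List.mem_flatMap.1 hc
      refine ⟨_, ⟨p, hp, rfl⟩, (hmem p hp u v).2 ?_⟩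
      obtain ⟨⟨a, b⟩, hd, hc⟩ := List.mem_map.1 hc
      obtain ⟨i, j, -, hu, hv⟩ := (sun_darts _ _ _).1 hd
      have hb : b < N := hv ▸ hlt p hp j
      have hv' := v.2
      simp only at hc
      have e2 : b = v.1 := by
        have := congrArg (· % N) hc
        simpa [Nat.mul_add_mod', Nat.mod_eq_of_lt hb, Nat.mod_eq_of_lt hv'] using this
      have e1 : a = u.1 := by
        rw [e2] at hc
        exact Nat.eq_of_mul_eq_mul_right (by omega) (Nat.add_right_cancel hc)
      rw [← e1, ← e2]; exact hd
  · rintro s ⟨p, hp, rfl⟩ t ⟨q, hq, rfl⟩ hne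
    have hpq : p ≠ q := by rintro rfl; exact hne rfl
    have := (List.nodup_flatMap.1 k1).2
    have hd : List.Disjoint (codes N p) (codes N q) := by
      have hsy : Std.Symm (Function.onFun List.Disjoint (codes N)) := ⟨fun _ _ h => h.symm⟩
      exact this.forall hp hq hpq
    rw [Function.onFun, id, id, Set.disjoint_left]
    intro e h1 h2
    induction e with | _ u v =>
    rw [hmem p hp] at h1
    rw [hmem q hq] at h2
    exact hd (List.mem_map_of_mem (f := fun d : ℕ × ℕ => d.1 * N + d.2) h1)
      (List.mem_map_of_mem (f := fun d : ℕ × ℕ => d.1 * N + d.2) h2)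
  · rintro s ⟨p, hp, rfl⟩
    refine ⟨F p hp, fun i j hij => fn_inj p (nodupB_spec _ (h1 p hp).1.1) ?_, rfl⟩
    exact congrArg Fin.val hij

/-! Certificates -/

def adjP (q u v : ℕ) : Bool :=
  !(Nat.beq u v) && (Nat.beq (u / q) (v / q) || Nat.beq (u % q) (v % q))

def adjB (p u v : ℕ) : Bool := Nat.blt u p != Nat.blt v p

def nine : List Pc := [
  ⟨14, 3, 1, 12, 8, 11, 4, 9⟩, ⟨2, 15, 12, 7, 4, 9, 6, 13⟩, ⟨8, 10, 4, 6, 0, 2, 9, 14⟩,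
  ⟨5, 13, 10, 15, 8, 2, 12, 4⟩, ⟨6, 1, 9, 3, 11, 15, 14, 13⟩, ⟨7, 5, 11, 9, 10, 0, 13, 6⟩,
  ⟨1, 14, 4, 7, 11, 0, 12, 15⟩, ⟨2, 5, 3, 0, 12, 10, 8, 6⟩, ⟨0, 11, 8, 13, 10, 14, 2, 15⟩]

def L11_7 : List Pc := (List.range 11).flatMap fun x => (List.range 7).map fun y =>
  let c := fun a b => (x + a) % 11 * 7 + (y + b) % 7
  ⟨c 0 0, c 1 0, c 5 0, c 3 0, c 6 0, c 1 1, c 5 2, c 3 3⟩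

def L11_16 : List Pc :=
  ((List.range 11).flatMap fun x => (List.range 16).map fun y =>
    let c := fun a b => (x + a) % 11 * 16 + (y + b) % 16
    ⟨c 0 0, c 1 0, c 5 0, c 3 0, c 6 0, c 1 1, c 5 4, c 3 7⟩) ++
  (List.range 11).flatMap fun x => nine.map (Pc.map fun v => x * 16 + v)

def L7_16 : List Pc :=
  ((List.range 7).flatMap fun x => (List.range 4).map fun y =>
    let c := fun a b => (x + a) % 7 * 16 + (y + b) % 16
    ⟨c 0 0, c 0 4, c 0 8, c 0 12, c 1 0, c 1 4, c 1 8, c 1 12⟩) ++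
  ((List.range 7).flatMap fun x => (List.range 8).map fun y =>
    let c := fun a b => (x + a) % 7 * 16 + (y + b) % 16
    ⟨c 0 0, c 0 1, c 0 8, c 0 9, c 2 0, c 3 1, c 2 8, c 3 9⟩) ++
  (List.range 7).flatMap fun x => nine.map (Pc.map fun v => x * 16 + v)

def L16 : List Pc := (List.range 15).map fun x =>
  let c := fun a => (x + a) % 15
  ⟨c 0, c 1, c 5, c 3, 15, c 6, c 11, c 10⟩

def LB4 : List Pc := (List.range 4).flatMap fun k =>
  [⟨0, 4 + 4 * k, 1, 5 + 4 * k, 6 + 4 * k, 2, 7 + 4 * k, 3⟩,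
   ⟨2, 6 + 4 * k, 3, 7 + 4 * k, 5 + 4 * k, 1, 4 + 4 * k, 0⟩]

def LB7 : List Pc := (List.range 2).flatMap fun k => (List.range 7).map fun x =>
  let l := fun a => (x + a) % 7
  let r := fun a => 7 + 8 * k + (x + a) % 7
  ⟨l 0, r 1, l 1, r 4, 14 + 8 * k, l 3, r 3, l 5⟩

set_option maxRecDepth 1000000
lemma c1 : chk 77 (adjP 7) L11_7 = true := by decide +kernel
lemma c2 : chk 176 (adjP 16) L11_16 = true := by decide +kernel
lemma c3 : chk 112 (adjP 16) L7_16 = true := by decide +kernel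
lemma c4 : chk 16 (fun u v => !(Nat.beq u v)) L16 = true := by decide +kernel
lemma c5 : chk 20 (adjB 4) LB4 = true := by decide +kernel
lemma c6 : chk 23 (adjB 7) LB7 = true := by decide +kernel

theorem D_glue {V ι : Type} {W : ι → Type} (G : SimpleGraph V) (K : ∀ i, SimpleGraph (W i))
    (f : ∀ i, W i → V) (hf : ∀ i, Function.Injective (f i))
    (hK : ∀ i, HasSunletDecomposition (K i))
    (h1 : ∀ i a b, (K i).Adj a b → G.Adj (f i a) (f i b))
    (h2 : ∀ u v, G.Adj u v → ∃ i a b, (K i).Adj a b ∧ f i a = u ∧ f i b = v)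
    (h3 : ∀ i j a b c d, (K i).Adj a b → (K j).Adj c d → f i a = f j c → f i b = f j d → i = j) :
    HasSunletDecomposition G := by
  choose P hU hD hS using hK
  have hin : ∀ i, ∀ s ∈ P i, ∀ e ∈ s, e ∈ (K i).edgeSet := by
    intro i s hs e he
    rw [← hU i]; exact ⟨s, hs, he⟩
  refine ⟨{t | ∃ i, ∃ s ∈ P i, t = Sym2.map (f i) '' s}, ?_, ?_, ?_⟩
  · ext e
    constructor
    · rintro ⟨t, ⟨i, s, hs, rfl⟩, e', he', rfl⟩
      have := hin i s hs e' he'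
      induction e' with | _ a b =>
      exact h1 i a b this
    · intro he
      induction e with | _ u v =>
      obtain ⟨i, a, b, hab, rfl, rfl⟩ := h2 u v he
      have : s(a, b) ∈ ⋃₀ P i := by rw [hU i]; exact hab
      obtain ⟨s, hs, hab'⟩ := this
      exact ⟨_, ⟨i, s, hs, rfl⟩, s(a, b), hab', rfl⟩
  · rintro t ⟨i, s, hs, rfl⟩ t' ⟨j, s', hs', rfl⟩ hne
    rw [Function.onFun, id, id, Set.disjoint_left]
    rintro e ⟨e1, he1, rfl⟩ ⟨e2, he2, h⟩
    have hij : i = j := by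
      have k1 := hin i s hs e1 he1
      have k2 := hin j s' hs' e2 he2
      induction e1 with | _ a b =>
      induction e2 with | _ c d =>
      rw [SimpleGraph.mem_edgeSet] at k1 k2
      rw [Sym2.map_mk, Sym2.map_mk, Sym2.eq_iff] at h
      rcases h with ⟨x, y⟩ | ⟨x, y⟩
      · exact h3 i j a b c d k1 k2 x.symm y.symm
      · exact h3 i j a b d c k1 k2.symm y.symm x.symm
    subst hij
    have := Sym2.map.injective (hf i) h
    subst this
    have hss : s ≠ s' := by rintro rfl; exact hne rfl
    exact Set.disjoint_left.1 (hD i hs hs' hss) he1 he2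
  · rintro t ⟨i, s, hs, rfl⟩
    obtain ⟨g, hg, rfl⟩ := hS i s hs
    refine ⟨f i ∘ g, (hf i).comp hg, ?_⟩
    rw [← Set.image_comp, Sym2.map_comp]

theorem D_iso {V W : Type} (G : SimpleGraph V) (H : SimpleGraph W) (e : W ≃ V)
    (h : ∀ a b, H.Adj a b ↔ G.Adj (e a) (e b)) (hH : HasSunletDecomposition H) :
    HasSunletDecomposition G := by
  refine D_glue (ι := Unit) G (fun _ => H) (fun _ => e) (fun _ => e.injective) (fun _ => hH)
    (fun _ a b => (h a b).1) (fun u v huv => ⟨(), e.symm u, e.symm v, ?_, by simp, by simp⟩)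
    (fun _ _ _ _ _ _ _ _ _ _ => rfl)
  rw [h]; simpa using huv

abbrev KK (X Y : Type) : SimpleGraph (X × Y) := (⊤ : SimpleGraph X) □ (⊤ : SimpleGraph Y)

theorem KK_congr {X Y X' Y' : Type} (e : X ≃ X') (f : Y ≃ Y')
    (h : HasSunletDecomposition (KK X Y)) : HasSunletDecomposition (KK X' Y') :=
  D_iso _ _ (e.prodCongr f) (by rintro ⟨a, b⟩ ⟨c, d⟩; simp [SimpleGraph.boxProd_adj]) h

theorem KK_symm {X Y : Type} (h : HasSunletDecomposition (KK X Y)) :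
    HasSunletDecomposition (KK Y X) :=
  D_iso _ _ (Equiv.prodComm X Y)
    (by rintro ⟨a, b⟩ ⟨c, d⟩; simp [SimpleGraph.boxProd_adj]; tauto) h

theorem KK_sum {X Z Y : Type} (h1 : HasSunletDecomposition (KK X Y))
    (h2 : HasSunletDecomposition (KK Z Y))
    (h3 : HasSunletDecomposition (completeBipartiteGraph X Z)) :
    HasSunletDecomposition (KK (X ⊕ Z) Y) := by
  refine D_glue (ι := Option (Option Y))
    (W := fun i => match i with
      | none => X × Y
      | some none => Z × Y
      | some (some _) => X ⊕ Z) _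
    (fun i => match i with
      | none => KK X Y
      | some none => KK Z Y
      | some (some _) => completeBipartiteGraph X Z)
    (fun i => match i with
      | none => fun w => (Sum.inl w.1, w.2)
      | some none => fun w => (Sum.inr w.1, w.2)
      | some (some y) => fun w => (w, y)) ?_ ?_ ?_ ?_ ?_
  · rintro (_ | _ | y)
    · rintro ⟨a, b⟩ ⟨c, d⟩ h; simpa using h
    · rintro ⟨a, b⟩ ⟨c, d⟩ h; simpa using h
    · rintro a b h; simpa using h
  · rintro (_ | _ | y)
    exacts [h1, h2, h3]
  · rintro (_ | _ | y)
    · rintro ⟨a, b⟩ ⟨c, d⟩ h; simpa [SimpleGraph.boxProd_adj] using h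
    · rintro ⟨a, b⟩ ⟨c, d⟩ h; simpa [SimpleGraph.boxProd_adj] using h
    · rintro (a | a) (b | b) h <;> simp [SimpleGraph.boxProd_adj] at h ⊢
  · rintro ⟨a | a, b⟩ ⟨c | c, d⟩ h
    · exact ⟨none, (a, b), (c, d), by simpa [SimpleGraph.boxProd_adj] using h, rfl, rfl⟩
    · have : b = d := by simpa [SimpleGraph.boxProd_adj] using h
      subst this
      exact ⟨some (some b), Sum.inl a, Sum.inr c, by simp, rfl, rfl⟩
    · have : b = d := by simpa [SimpleGraph.boxProd_adj] using h
      subst this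
      exact ⟨some (some b), Sum.inr a, Sum.inl c, by simp, rfl, rfl⟩
    · exact ⟨some none, (a, b), (c, d), by simpa [SimpleGraph.boxProd_adj] using h, rfl, rfl⟩
  · rintro (_ | _ | y) (_ | _ | y') a b c d hab hcd h h'
    · rfl
    · simp at h
    · obtain ⟨rfl, -⟩ := Prod.ext_iff.1 h
      obtain ⟨rfl, -⟩ := Prod.ext_iff.1 h'
      simp at hcd
    · simp at h
    · rfl
    · obtain ⟨rfl, -⟩ := Prod.ext_iff.1 h
      obtain ⟨rfl, -⟩ := Prod.ext_iff.1 h'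
      simp at hcd
    · obtain ⟨h, -⟩ := Prod.ext_iff.1 h
      obtain ⟨h', -⟩ := Prod.ext_iff.1 h'
      simp only at h h'
      subst h h'
      simp at hab
    · obtain ⟨h, -⟩ := Prod.ext_iff.1 h
      obtain ⟨h', -⟩ := Prod.ext_iff.1 h'
      simp only at h h'
      subst h h'
      simp at hab
    · obtain ⟨-, h⟩ := Prod.ext_iff.1 h
      simp only at h
      rw [h]

theorem KK_top {X Y : Type} (h1 : HasSunletDecomposition (⊤ : SimpleGraph X))
    (h2 : HasSunletDecomposition (⊤ : SimpleGraph Y)) : HasSunletDecomposition (KK X Y) := by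
  refine D_glue (ι := Y ⊕ X)
    (W := fun i => match i with
      | Sum.inl _ => X
      | Sum.inr _ => Y) _
    (fun i => match i with
      | Sum.inl _ => (⊤ : SimpleGraph X)
      | Sum.inr _ => (⊤ : SimpleGraph Y))
    (fun i => match i with
      | Sum.inl y => fun w => (w, y)
      | Sum.inr x => fun w => (x, w)) ?_ ?_ ?_ ?_ ?_
  · rintro (y | x) a b h <;> simpa using h
  · rintro (y | x)
    exacts [h1, h2]
  · rintro (y | x) a b h <;> simpa [SimpleGraph.boxProd_adj] using h
  · rintro ⟨a, b⟩ ⟨c, d⟩ h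
    simp only [SimpleGraph.boxProd_adj] at h
    rcases h with ⟨h, rfl⟩ | ⟨h, rfl⟩
    · exact ⟨Sum.inl b, a, c, h, rfl, rfl⟩
    · exact ⟨Sum.inr a, b, d, h, rfl, rfl⟩
  · rintro (y | x) (y' | x') a b c d hab hcd h h' <;>
      rw [Prod.ext_iff] at h h' <;> simp only at h h'
    · rw [h.2]
    · exact absurd (h.1.trans h'.1.symm) hab
    · exact absurd (h.2.trans h'.2.symm) hab
    · rw [h.1]

theorem B_sum {X Z Y : Type} (h1 : HasSunletDecomposition (completeBipartiteGraph X Y))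
    (h2 : HasSunletDecomposition (completeBipartiteGraph Z Y)) :
    HasSunletDecomposition (completeBipartiteGraph (X ⊕ Z) Y) := by
  refine D_glue (ι := Bool)
    (W := fun i => match i with
      | true => X ⊕ Y
      | false => Z ⊕ Y) _
    (fun i => match i with
      | true => completeBipartiteGraph X Y
      | false => completeBipartiteGraph Z Y)
    (fun i => match i with
      | true => Sum.map Sum.inl id
      | false => Sum.map Sum.inr id) ?_ ?_ ?_ ?_ ?_
  · rintro (_ | _)
    · exact Sum.inr_injective.sumMap Function.injective_id
    · exact Sum.inl_injective.sumMap Function.injective_id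
  · rintro (_ | _)
    exacts [h2, h1]
  · rintro (_ | _) (a | a) (b | b) h <;> simp at h ⊢
  · rintro ((a | a) | a) ((b | b) | b) h <;> simp at h
    · exact ⟨true, Sum.inl a, Sum.inr b, by simp, rfl, rfl⟩
    · exact ⟨false, Sum.inl a, Sum.inr b, by simp, rfl, rfl⟩
    · exact ⟨true, Sum.inr a, Sum.inl b, by simp, rfl, rfl⟩
    · exact ⟨false, Sum.inr a, Sum.inl b, by simp, rfl, rfl⟩
  · rintro (_ | _) (_ | _) (a | a) (b | b) (c | c) (d | d) hab hcd h h' <;>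
      simp at hab hcd h h' ⊢

theorem B_congr {X Y X' : Type} (e : X ≃ X')
    (h : HasSunletDecomposition (completeBipartiteGraph X Y)) :
    HasSunletDecomposition (completeBipartiteGraph X' Y) :=
  D_iso _ _ (e.sumCongr (Equiv.refl Y)) (by rintro (a | a) (b | b) <;> simp) h

theorem KK_chk (p q : ℕ) (L : List Pc) (h : chk (p * q) (adjP q) L = true) :
    HasSunletDecomposition (KK (Fin p) (Fin q)) := by
  let G : SimpleGraph (Fin (p * q)) := (KK (Fin p) (Fin q)).comap finProdFinEquiv.symm
  refine D_iso _ G finProdFinEquiv.symm (fun _ _ => Iff.rfl) (chk_spec _ _ L h G ?_)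
  intro u v
  obtain ⟨⟨a, b⟩, rfl⟩ := finProdFinEquiv.surjective u
  obtain ⟨⟨c, d⟩, rfl⟩ := finProdFinEquiv.surjective v
  have hq : 0 < q := b.pos
  have e1 : ∀ (a : Fin p) (b : Fin q), (finProdFinEquiv (a, b)).1 / q = a.1 := by
    intro a b
    simp [Nat.add_mul_div_left _ _ hq]
  have e2 : ∀ (a : Fin p) (b : Fin q), (finProdFinEquiv (a, b)).1 % q = b.1 := by
    intro a b
    simp [Nat.mod_eq_of_lt b.2]
  simp only [adjP, e1, e2, G, SimpleGraph.comap_adj, Equiv.symm_apply_apply,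
    SimpleGraph.boxProd_adj, Bool.and_eq_true, Bool.or_eq_true, Nat.beq_eq,
    Bool.not_eq_true', ← Bool.not_eq_true, SimpleGraph.top_adj]
  have e3 : (finProdFinEquiv (a, b)).1 = (finProdFinEquiv (c, d)).1 ↔ (a = c ∧ b = d) := by
    rw [← Fin.ext_iff, finProdFinEquiv.injective.eq_iff, Prod.mk.injEq]
  rw [e3, ← Fin.ext_iff, ← Fin.ext_iff]
  tauto

theorem B_chk (p q : ℕ) (L : List Pc) (h : chk (p + q) (adjB p) L = true) :
    HasSunletDecomposition (completeBipartiteGraph (Fin p) (Fin q)) := by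
  let G : SimpleGraph (Fin (p + q)) :=
    (completeBipartiteGraph (Fin p) (Fin q)).comap finSumFinEquiv.symm
  refine D_iso _ G finSumFinEquiv.symm (fun _ _ => Iff.rfl) (chk_spec _ _ L h G ?_)
  intro u v
  have hl : ∀ a : Fin p, Nat.blt a.1 p = true := fun a => by simp [Nat.blt_eq]
  have hr : ∀ a : Fin q, Nat.blt (p + a.1) p = false := fun a => by
    rw [← Bool.not_eq_true, Nat.blt_eq]; omega
  obtain ⟨a | a, rfl⟩ := finSumFinEquiv.surjective u <;>
  obtain ⟨b | b, rfl⟩ := finSumFinEquiv.surjective v <;>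
  simp [adjB, G, hl, hr]

theorem top16 : HasSunletDecomposition (⊤ : SimpleGraph (Fin 16)) :=
  chk_spec _ _ _ c4 _ (by intro u v; simp [Fin.ext_iff, ← Bool.not_eq_true])

theorem B4 (k : ℕ) : HasSunletDecomposition (completeBipartiteGraph (Fin (7 + 4 * k)) (Fin 16)) := by
  induction k with
  | zero => exact B_chk 7 16 _ c6
  | succ k ih => exact B_congr (X := Fin (7 + 4 * k) ⊕ Fin 4) finSumFinEquiv (B_sum ih (B_chk 4 16 _ c5))

theorem KK_step (m n : ℕ) (k : ℕ) (hm : m = 7 + 4 * k)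
    (h1 : HasSunletDecomposition (KK (Fin m) (Fin n)))
    (h2 : HasSunletDecomposition (KK (Fin 16) (Fin n))) :
    ∀ a, HasSunletDecomposition (KK (Fin (m + 16 * a)) (Fin n)) := by
  intro a
  induction a with
  | zero => exact h1
  | succ a ih =>
    refine KK_congr (X := Fin (m + 16 * a) ⊕ Fin 16) finSumFinEquiv (Equiv.refl _)
      (KK_sum ih h2 ?_)
    have := B4 (k + 4 * a)
    have e : 7 + 4 * (k + 4 * a) = m + 16 * a := by omega
    rwa [e] at this

theorem stmt_7 (m n : ℕ) (hm : 0 < m) (hn : 0 < n) (h1 : m % 16 = 11) (h2 : n % 16 = 7) :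
    HasSunletDecomposition ((⊤ : SimpleGraph (Fin m)) □ (⊤ : SimpleGraph (Fin n))) := by
  obtain ⟨a, rfl⟩ : ∃ a, m = 11 + 16 * a := ⟨m / 16, by omega⟩
  obtain ⟨b, rfl⟩ : ∃ b, n = 7 + 16 * b := ⟨n / 16, by omega⟩
  refine KK_step 11 _ 1 rfl (KK_symm ?_) (KK_symm ?_) a
  · exact KK_step 7 11 0 rfl (KK_symm (KK_chk 11 7 _ c1)) (KK_symm (KK_chk 11 16 _ c2)) b
  · exact KK_step 7 16 0 rfl (KK_chk 7 16 _ c3) (KK_top top16 top16) b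
end

section
/- The graph K_16 □ K_7 has an L_8-decomposition. -/
open SimpleGraph

/-- Base blocks; vertex `(a, h)` is coded as `7 * a + h`. -/
def baseTab : List (List ℕ) :=
  [[0, 14, 84, 35, 1, 15, 85, 36],
   [35, 49, 14, 70, 37, 50, 16, 71],
   [70, 84, 49, 0, 72, 86, 51, 2],
   [0, 21, 28, 63, 3, 22, 29, 64],
   [35, 56, 63, 98, 38, 57, 65, 99],
   [70, 91, 98, 28, 73, 92, 100, 30],
   [7, 14, 56, 42, 8, 17, 58, 43],
   [42, 49, 91, 77, 44, 52, 93, 78],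
   [77, 84, 21, 7, 79, 87, 23, 9],
   [7, 91, 63, 105, 10, 94, 66, 106],
   [42, 21, 98, 105, 45, 24, 101, 107],
   [77, 56, 28, 105, 80, 59, 31, 108],
   [84, 28, 77, 0, 42, 7, 49, 91],
   [14, 63, 7, 35, 77, 42, 84, 21],
   [49, 98, 42, 70, 7, 77, 14, 56],
   [35, 91, 56, 105, 77, 14, 7, 49],
   [70, 21, 91, 105, 7, 49, 42, 84],
   [0, 56, 21, 105, 42, 84, 77, 14],
   [63, 70, 98, 84, 21, 77, 7, 91],
   [98, 0, 28, 14, 56, 7, 42, 21],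
   [28, 35, 63, 49, 91, 42, 77, 56]]

def vtx (i : Fin 21) (j : Fin 8) (t : Fin 7) : Fin 16 × Fin 7 :=
  let c := (baseTab.getD i.val []).getD j.val 0
  (Fin.ofNat 16 (c / 7), Fin.ofNat 7 (c % 7 + t.val))

/-- The two ends of the eight edges of the sunlet. -/
def e1 (k : Fin 8) : Fin 8 := Fin.ofNat 8 (k.val % 4)
def e2 (k : Fin 8) : Fin 8 := if k.val < 4 then Fin.ofNat 8 ((k.val + 1) % 4) else k

/-- Orbit and level of an edge. -/
def key (u v : Fin 16 × Fin 7) : ℕ × ℕ :=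
  if u.2.val = v.2.val then (100 * min u.1.val v.1.val + max u.1.val v.1.val, u.2.val)
  else
    let d := (v.2.val + 7 - u.2.val) % 7
    if d ≤ 3 then (2000 + 10 * u.1.val + d, u.2.val)
    else (2000 + 10 * u.1.val + (7 - d), v.2.val)

def orbN (i : Fin 21) (k : Fin 8) : ℕ := (key (vtx i (e1 k) 0) (vtx i (e2 k) 0)).1

theorem sunlet_edges (a b : Fin 8) :
    sunlet8.Adj a b ↔ ∃ k, (e1 k = a ∧ e2 k = b) ∨ (e1 k = b ∧ e2 k = a) := by
  simp only [sunlet8, SimpleGraph.fromRel_adj]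
  revert a b
  decide +kernel

theorem vtx_inj : ∀ i t j j', vtx i j t = vtx i j' t → j = j' := by decide +kernel

theorem vtx_adj : ∀ i k t, (((vtx i (e1 k) t).1 ≠ (vtx i (e2 k) t).1 ∧
    (vtx i (e1 k) t).2 = (vtx i (e2 k) t).2) ∨ ((vtx i (e1 k) t).2 ≠ (vtx i (e2 k) t).2 ∧
    (vtx i (e1 k) t).1 = (vtx i (e2 k) t).1)) := by decide +kernel

theorem key_vtx : ∀ i k t, key (vtx i (e1 k) t) (vtx i (e2 k) t) = (orbN i k, t.val) ∧
    key (vtx i (e2 k) t) (vtx i (e1 k) t) = (orbN i k, t.val) := by decide +kernel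

theorem orbN_inj : ∀ i k i' k', orbN i k = orbN i' k' → i = i' := by decide +kernel

def cod (i : Fin 21) (j : Fin 8) : ℕ := (baseTab.getD i.val []).getD j.val 0

theorem vtx_of_cod (i : Fin 21) (j : Fin 8) (t : Fin 7) (a : Fin 16) (d : Fin 7)
    (h : cod i j = 7 * a.val + d.val) : vtx i j t = (a, d + t) := by
  have ha := a.isLt
  have hd := d.isLt
  unfold cod at h
  unfold vtx
  simp only [h]
  refine Prod.ext (Fin.ext ?_) (Fin.ext ?_)
  · simp only [Fin.val_ofNat]
    omega
  · simp only [Fin.val_ofNat, Fin.val_add]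
    omega

theorem cod1 : ∀ a b : Fin 16, a.val < b.val → ∃ i k,
    (cod i (e1 k) = 7 * a.val ∧ cod i (e2 k) = 7 * b.val) ∨
    (cod i (e1 k) = 7 * b.val ∧ cod i (e2 k) = 7 * a.val) := by decide +kernel

theorem cod2 : ∀ (a : Fin 16) (d : Fin 3), ∃ (i : Fin 12) (k : Fin 4),
    cod (i.castLE (by decide)) (e1 (k.natAdd 4)) = 7 * a.val ∧
    cod (i.castLE (by decide)) (e2 (k.natAdd 4)) = 7 * a.val + (d.val + 1) := by decide +kernel

theorem cover1 (a b : Fin 16) (hn : a ≠ b) : ∃ i k, ∀ t : Fin 7,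
    (vtx i (e1 k) t = (a, t) ∧ vtx i (e2 k) t = (b, t)) ∨
    (vtx i (e1 k) t = (b, t) ∧ vtx i (e2 k) t = (a, t)) := by
  have key0 : ∀ i j t (a : Fin 16), cod i j = 7 * a.val → vtx i j t = (a, t) := by
    intro i j t a h
    simpa using vtx_of_cod i j t a 0 (by simpa using h)
  rcases lt_or_gt_of_ne (fun h => hn (Fin.ext h) : a.val ≠ b.val) with h | h
  · obtain ⟨i, k, h⟩ := cod1 a b h
    refine ⟨i, k, fun t => ?_⟩
    exact h.imp (fun h => ⟨key0 _ _ _ _ h.1, key0 _ _ _ _ h.2⟩)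
      (fun h => ⟨key0 _ _ _ _ h.1, key0 _ _ _ _ h.2⟩)
  · obtain ⟨i, k, h⟩ := cod1 b a h
    refine ⟨i, k, fun t => ?_⟩
    exact h.symm.imp (fun h => ⟨key0 _ _ _ _ h.1, key0 _ _ _ _ h.2⟩)
      (fun h => ⟨key0 _ _ _ _ h.1, key0 _ _ _ _ h.2⟩)

theorem diff7 : ∀ h h' : Fin 7, h ≠ h' → ∃ d : Fin 3,
    h' = Fin.succ (d.castLE (by decide : 3 ≤ 6)) + h ∨
    h = Fin.succ (d.castLE (by decide : 3 ≤ 6)) + h' := by decide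

theorem cover2 (a : Fin 16) (h h' : Fin 7) (hn : h ≠ h') : ∃ t i k,
    (vtx i (e1 k) t = (a, h) ∧ vtx i (e2 k) t = (a, h')) ∨
    (vtx i (e1 k) t = (a, h') ∧ vtx i (e2 k) t = (a, h)) := by
  obtain ⟨d, hd⟩ := diff7 h h' hn
  obtain ⟨i, k, h1, h2⟩ := cod2 a d
  have h1' := fun t => vtx_of_cod _ _ t a 0 (by simpa using h1)
  have h2' := fun t => vtx_of_cod _ _ t a (Fin.succ (d.castLE (by decide : 3 ≤ 6)))
    (by simpa using h2)
  rcases hd with hd | hd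
  · exact ⟨h, _, _, Or.inl ⟨by simpa using h1' h, by rw [hd]; exact h2' h⟩⟩
  · exact ⟨h', _, _, Or.inr ⟨by simpa using h1' h', by rw [hd]; exact h2' h'⟩⟩

def blk (i : Fin 21) (t : Fin 7) : Set (Sym2 (Fin 16 × Fin 7)) :=
  Sym2.map (fun j => vtx i j t) '' sunlet8.edgeSet

theorem mem_blk (i : Fin 21) (t : Fin 7) (e : Sym2 (Fin 16 × Fin 7)) :
    e ∈ blk i t ↔ ∃ k, s(vtx i (e1 k) t, vtx i (e2 k) t) = e := by
  constructor
  · rintro ⟨s, hs, rfl⟩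
    induction s with
    | _ a b =>
      rw [SimpleGraph.mem_edgeSet, sunlet_edges] at hs
      obtain ⟨k, ⟨rfl, rfl⟩ | ⟨rfl, rfl⟩⟩ := hs
      · exact ⟨k, rfl⟩
      · exact ⟨k, Sym2.eq_swap⟩
  · rintro ⟨k, rfl⟩
    refine ⟨s(e1 k, e2 k), ?_, rfl⟩
    rw [SimpleGraph.mem_edgeSet, sunlet_edges]
    exact ⟨k, Or.inl ⟨rfl, rfl⟩⟩

theorem blk_disj (i i' : Fin 21) (t t' : Fin 7) (e : Sym2 (Fin 16 × Fin 7))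
    (h : e ∈ blk i t) (h' : e ∈ blk i' t') : i = i' ∧ t = t' := by
  rw [mem_blk] at h h'
  obtain ⟨k, rfl⟩ := h
  obtain ⟨k', h'⟩ := h'
  have h1 := (key_vtx i k t).1
  have h2 := key_vtx i' k' t'
  have h3 : (orbN i k, t.val) = (orbN i' k', t'.val) := by
    rw [Sym2.eq_iff] at h'
    rcases h' with ⟨ha, hb⟩ | ⟨ha, hb⟩
    · rw [← h1, ← h2.1, ha, hb]
    · rw [← h1, ← h2.2, ha, hb]
  rw [Prod.mk.injEq] at h3
  exact ⟨orbN_inj _ _ _ _ h3.1, Fin.ext h3.2⟩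

theorem stmt_13 :
    HasSunletDecomposition ((⊤ : SimpleGraph (Fin 16)) □ (⊤ : SimpleGraph (Fin 7))) := by
  refine ⟨{s | ∃ i t, s = blk i t}, ?_, ?_, ?_⟩
  · ext e
    simp only [Set.mem_sUnion, Set.mem_ofPred_eq]
    constructor
    · rintro ⟨_, ⟨i, t, rfl⟩, he⟩
      rw [mem_blk] at he
      obtain ⟨k, rfl⟩ := he
      rw [SimpleGraph.mem_edgeSet, SimpleGraph.boxProd_adj]
      simpa only [SimpleGraph.top_adj] using vtx_adj i k t
    · intro he
      induction e with
      | _ u v =>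
        obtain ⟨a, h⟩ := u
        obtain ⟨b, h'⟩ := v
        rw [SimpleGraph.mem_edgeSet, SimpleGraph.boxProd_adj] at he
        simp only [SimpleGraph.top_adj] at he
        rcases he with ⟨hn, rfl⟩ | ⟨hn, rfl⟩
        · obtain ⟨i, k, hk⟩ := cover1 a b hn
          refine ⟨_, ⟨i, h, rfl⟩, (mem_blk _ _ _).2 ⟨k, ?_⟩⟩
          rw [Sym2.eq_iff]
          exact hk h
        · obtain ⟨t, i, k, hk⟩ := cover2 a h h' hn
          refine ⟨_, ⟨i, t, rfl⟩, (mem_blk _ _ _).2 ⟨k, ?_⟩⟩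
          rw [Sym2.eq_iff]
          exact hk
  · rintro _ ⟨i, t, rfl⟩ _ ⟨i', t', rfl⟩ hne
    simp only [Function.onFun, id]
    rw [Set.disjoint_left]
    intro e h h'
    obtain ⟨rfl, rfl⟩ := blk_disj _ _ _ _ e h h'
    exact hne rfl
  · rintro _ ⟨i, t, rfl⟩
    exact ⟨fun j => vtx i j t, fun j j' h => vtx_inj i t j j' h, rfl⟩
end
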